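/- arXiv:1812.07690 — 5 statements merged into one kernel-verified Lean document; each statement's English description precedes it below -/
import Mathlib

section
/- Let m be a positive integer and ζ ∈ ℂ a primitive m-th root of unity. Then for every x ∈ ℂ, (1 − x^m) · D_ζ(ζx) = (1 − x)^m · D_ζ(x). -/
/-- The cyclic quantum dilogarithm `D_ζ(x) = ∏_{t=1}^{m-1} (1 - ζ^t x)^t`. -/
noncomputable def cyclicDilog (m : ℕ) (ζ x : ℂ) : ℂ :=
  ∏ t ∈ Finset.Icc 1 (m - 1), (1 - ζ ^ t * x) ^ t

theorem IsPrimitiveRoot.one_sub_pow_eq_prod_range {R : Type*} [CommRing R] [IsDomain R] {m : ℕ}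
    {ζ : R} (hm : 0 < m) (hζ : IsPrimitiveRoot ζ m) (x : R) :
    1 - x ^ m = ∏ t ∈ Finset.range m, (1 - ζ ^ t * x) := by
  classical
  have himage : Polynomial.nthRootsFinset m (1 : R) = (Finset.range m).image (ζ ^ ·) := by
    ext a
    rw [Polynomial.mem_nthRootsFinset hm, Finset.mem_image]
    constructor
    · intro ha
      have : NeZero m := ⟨hm.ne'⟩
      obtain ⟨i, hi, h⟩ := hζ.eq_pow_of_pow_eq_one ha
      exact ⟨i, Finset.mem_range.2 hi, h⟩
    · rintro ⟨i, -, rfl⟩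
      rw [← pow_mul, mul_comm, pow_mul, hζ.pow_eq_one, one_pow]
  have h := hζ.pow_sub_pow_eq_prod_sub_mul 1 x hm
  rw [one_pow, himage, Finset.prod_image] at h
  · exact h
  · intro i hi j hj hij
    exact hζ.pow_inj (Finset.mem_range.1 hi) (Finset.mem_range.1 hj) hij

theorem cyclicDilog_eq_prod_range {m : ℕ} (hm : 0 < m) (ζ x : ℂ) :
    cyclicDilog m ζ x = ∏ t ∈ Finset.range m, (1 - ζ ^ t * x) ^ t := by
  obtain ⟨n, rfl⟩ := Nat.exists_eq_succ_of_ne_zero hm.ne'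
  rw [cyclicDilog, Finset.prod_range_succ', pow_zero (1 - ζ ^ 0 * x), mul_one,
    Finset.range_eq_Ico, Finset.prod_Ico_add' (fun t ↦ (1 - ζ ^ t * x) ^ t)]
  rfl

theorem stmt_6 (m : ℕ) (hm : 0 < m) (ζ : ℂ) (hζ : IsPrimitiveRoot ζ m) (x : ℂ) :
    (1 - x ^ m) * cyclicDilog m ζ (ζ * x) = (1 - x) ^ m * cyclicDilog m ζ x := by
  have hpow : 1 - x ^ m = 1 - (ζ * x) ^ m := by rw [mul_pow, hζ.pow_eq_one, one_mul]
  calc (1 - x ^ m) * cyclicDilog m ζ (ζ * x)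
      = ∏ t ∈ Finset.range m, (1 - ζ ^ (t + 1) * x) ^ (t + 1) := by
        rw [hpow, hζ.one_sub_pow_eq_prod_range hm, cyclicDilog_eq_prod_range hm,
          ← Finset.prod_mul_distrib]
        refine Finset.prod_congr rfl fun t _ ↦ ?_
        rw [← mul_assoc, ← pow_succ, ← pow_succ']
    _ = ∏ t ∈ Finset.range (m + 1), (1 - ζ ^ t * x) ^ t := by
        rw [Finset.prod_range_succ', pow_zero (1 - ζ ^ 0 * x), mul_one]
    _ = (1 - x) ^ m * cyclicDilog m ζ x := by
        rw [Finset.prod_range_succ, hζ.pow_eq_one, one_mul, cyclicDilog_eq_prod_range hm, mul_comm]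
end

section
/- Let m be a positive integer, ζ ∈ ℂ a primitive m-th root of unity, and x, y, z ∈ ℂ satisfying z^m·(1 − y^m) = 1 − x^m. Then for every k ∈ ℕ, ( ∏_{j=1}^{k+m} (1 − ζ^j y) ) · z^{k+m} · ( ∏_{j=1}^{k} (1 − ζ^j x) ) = ( ∏_{j=1}^{k} (1 − ζ^j y) ) · z^{k} · ( ∏_{j=1}^{k+m} (1 − ζ^j x) ). In particular, when x^m ≠ 1 the sequence k ↦ (ζy;ζ)_k/(ζx;ζ)_k · z^k is periodic with period m, where (ζw;ζ)_k = ∏_{j=1}^{k}(1 − ζ^j w). -/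
open Polynomial in
/-- `∏_{i < m} (1 - ζ ^ i w) = 1 - w ^ m` for a primitive `m`-th root of unity `ζ`. -/
theorem IsPrimitiveRoot.prod_range_one_sub_pow_mul {R : Type*} [CommRing R] [IsDomain R]
    {m : ℕ} {ζ : R} (hζ : IsPrimitiveRoot ζ m) (hm : 0 < m) (w : R) :
    ∏ i ∈ Finset.range m, (1 - ζ ^ i * w) = 1 - w ^ m := by
  have h := congrArg (eval 1) (X_pow_sub_C_eq_prod hζ hm (rfl : w ^ m = w ^ m))
  simpa [eval_prod] using h.symm

/-- The shifted Pochhammer symbol `(ζw; ζ)_k` is multiplied by `1 - w ^ m` under `k ↦ k + m`. -/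
theorem IsPrimitiveRoot.prod_Icc_add_one_sub_pow_mul {R : Type*} [CommRing R] [IsDomain R]
    {m : ℕ} {ζ : R} (hζ : IsPrimitiveRoot ζ m) (hm : 0 < m) (w : R) (k : ℕ) :
    ∏ j ∈ Finset.Icc 1 (k + m), (1 - ζ ^ j * w) =
      (∏ j ∈ Finset.Icc 1 k, (1 - ζ ^ j * w)) * (1 - w ^ m) := by
  have hpow : (ζ ^ (k + 1) * w) ^ m = w ^ m := by
    rw [mul_pow, pow_right_comm, hζ.pow_eq_one, one_pow, one_mul]
  simp only [← Finset.Ico_add_one_right_eq_Icc, Finset.prod_Ico_eq_prod_range,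
    Nat.add_sub_cancel]
  rw [Finset.prod_range_add, ← hpow, ← hζ.prod_range_one_sub_pow_mul hm]
  congr 1
  refine Finset.prod_congr rfl fun i _ => ?_
  ring

theorem stmt_9 (m : ℕ) (hm : 0 < m) (ζ : ℂ) (hζ : IsPrimitiveRoot ζ m)
    (x y z : ℂ) (hrel : z ^ m * (1 - y ^ m) = 1 - x ^ m) :
    (∀ k : ℕ,
      (∏ j ∈ Finset.Icc 1 (k + m), (1 - ζ ^ j * y)) * z ^ (k + m) *
          ∏ j ∈ Finset.Icc 1 k, (1 - ζ ^ j * x) =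
        (∏ j ∈ Finset.Icc 1 k, (1 - ζ ^ j * y)) * z ^ k *
          ∏ j ∈ Finset.Icc 1 (k + m), (1 - ζ ^ j * x)) ∧
    (x ^ m ≠ 1 → ∀ k : ℕ,
      (∏ j ∈ Finset.Icc 1 (k + m), (1 - ζ ^ j * y)) /
          (∏ j ∈ Finset.Icc 1 (k + m), (1 - ζ ^ j * x)) * z ^ (k + m) =
        (∏ j ∈ Finset.Icc 1 k, (1 - ζ ^ j * y)) /
          (∏ j ∈ Finset.Icc 1 k, (1 - ζ ^ j * x)) * z ^ k) := by
  simp only [hζ.prod_Icc_add_one_sub_pow_mul hm]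
  refine ⟨fun k => ?_, fun hx k => ?_⟩
  · rw [← hrel]
    ring
  · have hx' : 1 - x ^ m ≠ 0 := sub_ne_zero.mpr hx.symm
    have hratio : (1 - y ^ m) / (1 - x ^ m) * z ^ m = 1 := by
      rw [div_mul_eq_mul_div, mul_comm, hrel, div_self hx']
    rw [mul_div_mul_comm, pow_add, mul_mul_mul_comm, hratio, mul_one]
end

section
/- Let N be a positive integer, φ : ℝ^N → ℂ a Schwartz function, and v ∈ ℝ^N. Then for every K ∈ ℕ, the function ε ↦ ∑_{k ∈ ℤ^N} φ( ε·(k + v) ) − ε^{−N} ∫_{ℝ^N} φ(x) dx is O(ε^K) as ε → 0⁺. -/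
open MeasureTheory

open scoped LineDeriv SchwartzMap

/-- The half-open unit cube `[0, 1) ^ N`. -/
def unitCube (N : ℕ) : Set (Fin N → ℝ) := Set.univ.pi fun _ => Set.Ico 0 1

/-- The point of `ℝ ^ N` with the given integer coordinates. -/
def latticePoint {N : ℕ} (k : Fin N → ℤ) : Fin N → ℝ := fun i => k i

/-- The sum of `φ` over the lattice `ε (ℤ ^ N + v)`. -/
noncomputable def latticeSum {N : ℕ} (φ : 𝓢(Fin N → ℝ, ℂ)) (ε : ℝ) (v : Fin N → ℝ) : ℂ :=
  ∑' k : Fin N → ℤ, φ (ε • (latticePoint k + v))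

section UnitCube

variable {N : ℕ}

theorem measurableSet_unitCube : MeasurableSet (unitCube N) :=
  MeasurableSet.univ_pi fun _ => measurableSet_Ico

theorem volume_unitCube : volume (unitCube N) = 1 := by
  simp [unitCube, volume_pi_pi]

theorem norm_le_one_of_mem_unitCube {y : Fin N → ℝ} (hy : y ∈ unitCube N) : ‖y‖ ≤ 1 := by
  refine (pi_norm_le_iff_of_nonneg zero_le_one).2 fun i => ?_
  have h := hy i (Set.mem_univ i)
  rw [Real.norm_of_nonneg h.1]
  exact h.2.le

theorem mem_image_add_unitCube_iff (k : Fin N → ℤ) (x : Fin N → ℝ) :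
    x ∈ (fun y => latticePoint k + y) '' unitCube N ↔ ∀ i, ⌊x i⌋ = k i := by
  rw [Set.image_add_left]
  simp only [unitCube, latticePoint, Set.mem_preimage, Set.mem_univ_pi, Pi.add_apply, Pi.neg_apply,
    Set.mem_Ico, Int.floor_eq_iff]
  refine forall_congr' fun i => ?_
  constructor <;> rintro ⟨h₁, h₂⟩ <;> constructor <;> linarith

theorem hasSum_setIntegral_unitCube {E : Type*} [NormedAddCommGroup E] [NormedSpace ℝ E]
    {f : (Fin N → ℝ) → E} (hf : Integrable f) :
    HasSum (fun k : Fin N → ℤ => ∫ y in unitCube N, f (latticePoint k + y)) (∫ x, f x) := by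
  have hU : ⋃ k : Fin N → ℤ, (fun y => latticePoint k + y) '' unitCube N = Set.univ := by
    refine Set.eq_univ_of_forall fun x => Set.mem_iUnion.2 ⟨fun i => ⌊x i⌋, ?_⟩
    exact (mem_image_add_unitCube_iff _ x).2 fun i => rfl
  have h := hasSum_integral_iUnion (μ := volume) (f := f)
    (s := fun k : Fin N → ℤ => (fun y => latticePoint k + y) '' unitCube N)
    (fun k => by
      rw [Set.image_add_left]
      exact (measurable_const_add _) measurableSet_unitCube)
    (fun k l hkl => Set.disjoint_left.2 fun x hk hl => hkl <| by
      rw [mem_image_add_unitCube_iff] at hk hl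
      exact funext fun i => (hk i).symm.trans (hl i))
    hf.integrableOn
  rw [hU, setIntegral_univ] at h
  convert h using 2 with k
  exact ((measurePreserving_add_left volume (latticePoint k)).setIntegral_image_emb
    (measurableEmbedding_addLeft _) f _).symm

/-- The integral over `ℝ ^ N` is the sum of the integrals over the cells of the lattice
`ε (ℤ ^ N + v)`. -/
theorem hasSum_setIntegral_unitCube_smul {E : Type*} [NormedAddCommGroup E] [NormedSpace ℝ E]
    {f : (Fin N → ℝ) → E} (hf : Integrable f) {ε : ℝ} (hε : 0 < ε) (v : Fin N → ℝ) :
    HasSum (fun k : Fin N → ℤ => ∫ y in unitCube N, f (ε • (latticePoint k + (v + y))))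
      ((ε ^ N)⁻¹ • ∫ x, f x) := by
  have h := hasSum_setIntegral_unitCube ((hf.comp_smul hε.ne').comp_add_right v)
  rw [integral_add_right_eq_self (fun x => f (ε • x)) v,
    Measure.integral_comp_smul_of_nonneg _ _ _ (hR := hε.le), Module.finrank_fin_fun] at h
  simpa only [add_assoc, add_comm v] using h

end UnitCube

section Decay

variable {N : ℕ}

theorem SchwartzMap.exists_norm_le_one_add_norm_rpow (φ : 𝓢(Fin N → ℝ, ℂ)) :
    ∃ C, 0 ≤ C ∧ ∀ x, ‖φ x‖ ≤ C * (1 + ‖x‖) ^ (-(N + 1 : ℝ)) := by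
  have h := SchwartzMap.one_add_le_sup_seminorm_apply (𝕜 := ℝ) (m := (N + 1, 0)) le_rfl le_rfl φ
  refine ⟨_, (by positivity : (0 : ℝ) ≤ _).trans (h 0), fun x => ?_⟩
  have hx := h x
  rw [norm_iteratedFDeriv_zero] at hx
  rw [Real.rpow_neg (by positivity), ← div_eq_mul_inv, le_div_iff₀ (by positivity), mul_comm]
  rw [← Nat.cast_add_one, Real.rpow_natCast]
  exact hx

/-- Values of a Schwartz function near the points of `ε (ℤ ^ N + v)` are dominated by a family
whose sum is bounded by a multiple of `ε ^ (-N)`, uniformly in `v`. -/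
theorem SchwartzMap.exists_lattice_majorant (φ : 𝓢(Fin N → ℝ, ℂ)) :
    ∃ C, 0 ≤ C ∧ ∀ ε : ℝ, 0 < ε → ε ≤ 1 → ∀ v : Fin N → ℝ, ∃ u : (Fin N → ℤ) → ℝ,
      Summable u ∧ ∑' k, u k ≤ C * (ε ^ N)⁻¹ ∧
      ∀ k w, ‖w‖ ≤ 2 → ‖φ (ε • (latticePoint k + (v + w)))‖ ≤ u k := by
  obtain ⟨A, hA, hφ⟩ := φ.exists_norm_le_one_add_norm_rpow
  set r : ℝ := N + 1 with hr
  set G : (Fin N → ℝ) → ℝ := fun x => (1 + ‖x‖) ^ (-r) with hG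
  have hGi : Integrable G := integrable_one_add_norm (by simp [hr])
  have hG0 : 0 ≤ ∫ x, G x := integral_nonneg fun x => by positivity
  refine ⟨A * 4 ^ r * ∫ x, G x, by positivity, fun ε hε hε1 v => ?_⟩
  have hsum := (hasSum_setIntegral_unitCube_smul hGi hε v).mul_left (A * 4 ^ r)
  refine ⟨_, hsum.summable, ?_, fun k w hw => ?_⟩
  · rw [hsum.tsum_eq, smul_eq_mul]
    exact le_of_eq (by ring)
  have hint : IntegrableOn (fun y => G (ε • (latticePoint k + (v + y)))) (unitCube N) := by
    have h := ((hGi.comp_smul hε.ne').comp_add_right (latticePoint k + v)).integrableOn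
      (s := unitCube N)
    refine h.congr_fun (fun y _ => ?_) measurableSet_unitCube
    simp only [add_comm y, add_assoc]
  rw [← integral_const_mul]
  calc ‖φ (ε • (latticePoint k + (v + w)))‖
      = ∫ y in unitCube N, ‖φ (ε • (latticePoint k + (v + w)))‖ := by
        simp [Measure.real, volume_unitCube]
    _ ≤ _ := by
        refine setIntegral_mono_on ?_ (hint.const_mul _) measurableSet_unitCube fun y hy => ?_
        · exact integrableOn_const (by simp [volume_unitCube])
        refine (hφ _).trans ?_
        rw [mul_assoc]
        refine mul_le_mul_of_nonneg_left ?_ hA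
        set a := ε • (latticePoint k + (v + w))
        set b := ε • (latticePoint k + (v + y))
        have hba : ‖b‖ ≤ ‖a‖ + 3 := by
          have hb : b = a + ε • (y - w) := by simp only [a, b, ← smul_add]; congr 1; abel
          have h1 : ‖ε • (y - w)‖ ≤ 3 := by
            rw [norm_smul, Real.norm_of_nonneg hε.le]
            have := norm_sub_le y w
            have := norm_le_one_of_mem_unitCube hy
            nlinarith [norm_nonneg (y - w)]
          rw [hb]
          linarith [norm_add_le a (ε • (y - w))]
        have h2 : (1 + ‖b‖) / 4 ≤ 1 + ‖a‖ := by linarith [norm_nonneg a]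
        calc (1 + ‖a‖) ^ (-r) ≤ ((1 + ‖b‖) / 4) ^ (-r) :=
              Real.rpow_le_rpow_of_nonpos (by positivity) h2 (by simp only [hr]; linarith)
          _ = 4 ^ r * G b := by
              rw [Real.div_rpow (by positivity) (by norm_num),
                Real.rpow_neg (by norm_num : (0 : ℝ) ≤ 4)]
              simp only [hG]
              rw [div_inv_eq_mul, mul_comm]

theorem SchwartzMap.integral_lineDeriv_eq_zero (φ : 𝓢(Fin N → ℝ, ℂ)) (m : Fin N → ℝ) :
    ∫ x, (∂_{m} φ) x = 0 := by
  have h := integral_smul_fderiv_eq_neg_fderiv_smul_of_integrable (μ := volume)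
    (f := fun _ : Fin N → ℝ => (1 : ℂ)) (g := φ) (v := m) (by simp)
    (by simpa [SchwartzMap.lineDerivOp_apply_eq_fderiv] using (∂_{m} φ).integrable)
    (by simpa using φ.integrable) (fun x _ => by fun_prop) (fun x _ => φ.differentiableAt)
  simpa [SchwartzMap.lineDerivOp_apply_eq_fderiv] using h

theorem SchwartzMap.hasDerivAt_comp_smul_add (φ : 𝓢(Fin N → ℝ, ℂ)) (ε : ℝ) (a v w : Fin N → ℝ)
    (t : ℝ) : HasDerivAt (fun t : ℝ => φ (ε • (a + (v + t • w))))
      (ε • (∂_{w} φ) (ε • (a + (v + t • w)))) t := by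
  have h0 : HasDerivAt (fun t : ℝ => t • w) w t := by
    simpa using (hasDerivAt_id t).smul_const w
  have h1 : HasDerivAt (fun t : ℝ => ε • (a + (v + t • w))) (ε • w) t :=
    ((h0.const_add v).const_add a).const_smul ε
  have h2 := (φ.differentiableAt (x := ε • (a + (v + t • w)))).hasFDerivAt.comp_hasDerivAt t h1
  rw [map_smul] at h2
  rw [SchwartzMap.lineDerivOp_apply_eq_fderiv]
  exact h2

end Decay

section LatticeSum

variable {N : ℕ}

theorem summable_lattice (φ : 𝓢(Fin N → ℝ, ℂ)) {ε : ℝ} (hε : 0 < ε) (hε1 : ε ≤ 1)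
    (v : Fin N → ℝ) : Summable fun k : Fin N → ℤ => φ (ε • (latticePoint k + v)) := by
  obtain ⟨C, -, h⟩ := φ.exists_lattice_majorant
  obtain ⟨u, hu, -, hb⟩ := h ε hε hε1 v
  exact .of_norm_bounded hu fun k => by simpa using hb k 0 (by simp)

theorem exists_norm_latticeSum_le (φ : 𝓢(Fin N → ℝ, ℂ)) :
    ∃ C, 0 ≤ C ∧ ∀ ε : ℝ, 0 < ε → ε ≤ 1 → ∀ v, ‖latticeSum φ ε v‖ ≤ C * (ε ^ N)⁻¹ := by
  obtain ⟨C, hC, h⟩ := φ.exists_lattice_majorant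
  refine ⟨C, hC, fun ε hε hε1 v => ?_⟩
  obtain ⟨u, hu, hle, hb⟩ := h ε hε hε1 v
  exact (tsum_of_norm_bounded hu.hasSum fun k => by simpa using hb k 0 (by simp)).trans hle

theorem integral_latticeSum (φ : 𝓢(Fin N → ℝ, ℂ)) {ε : ℝ} (hε : 0 < ε) (hε1 : ε ≤ 1)
    (v : Fin N → ℝ) :
    IntegrableOn (fun y => latticeSum φ ε (v + y)) (unitCube N) ∧
    ∫ y in unitCube N, latticeSum φ ε (v + y) = (ε ^ N)⁻¹ • ∫ x, φ x := by
  obtain ⟨C, -, h⟩ := φ.exists_lattice_majorant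
  obtain ⟨u, hu, -, hb⟩ := h ε hε hε1 v
  have hbd : ∀ k : Fin N → ℤ, ∀ y ∈ unitCube N, ‖φ (ε • (latticePoint k + (v + y)))‖ ≤ u k :=
    fun k y hy => hb k y ((norm_le_one_of_mem_unitCube hy).trans one_le_two)
  have : IsFiniteMeasure (volume.restrict (unitCube N)) := ⟨by simp [volume_unitCube]⟩
  have hint : ∀ k : Fin N → ℤ,
      IntegrableOn (fun y => φ (ε • (latticePoint k + (v + y)))) (unitCube N) := fun k =>
    Integrable.of_bound (by fun_prop) (u k)
      ((ae_restrict_iff' measurableSet_unitCube).2 (.of_forall (hbd k)))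
  constructor
  · refine Integrable.of_bound ?_ (∑' k, u k)
      ((ae_restrict_iff' measurableSet_unitCube).2 (.of_forall fun y hy => ?_))
    · refine ContinuousOn.aestronglyMeasurable ?_ measurableSet_unitCube
      exact continuousOn_tsum (fun k => by fun_prop) hu hbd
    · exact tsum_of_norm_bounded hu.hasSum fun k => hbd k y hy
  · refine HasSum.unique ?_ (hasSum_setIntegral_unitCube_smul φ.integrable hε v)
    refine hasSum_integral_of_summable_integral_norm hint ?_
    refine .of_nonneg_of_le (fun k => by positivity) (fun k => ?_) hu
    calc ∫ y in unitCube N, ‖φ (ε • (latticePoint k + (v + y)))‖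
        ≤ ∫ y in unitCube N, u k :=
          setIntegral_mono_on (hint k).norm (integrable_const _) measurableSet_unitCube (hbd k)
      _ = u k := by simp [Measure.real, volume_unitCube]

/-- If the lattice sums of all the partial derivatives of `φ` are bounded by `B`, then the lattice
sum of `φ` varies by at most `N ε B` under translations by vectors of norm at most one. -/
theorem norm_latticeSum_add_sub_le (φ : 𝓢(Fin N → ℝ, ℂ)) {ε B : ℝ} (hε : 0 < ε) (hε1 : ε ≤ 1)
    (hB : ∀ i v, ‖latticeSum (∂_{(Pi.single i 1 : Fin N → ℝ)} φ) ε v‖ ≤ B)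
    (v : Fin N → ℝ) {w : Fin N → ℝ} (hw : ‖w‖ ≤ 1) :
    ‖latticeSum φ ε (v + w) - latticeSum φ ε v‖ ≤ ε * (N * B) := by
  obtain ⟨C, -, h⟩ := (∂_{w} φ).exists_lattice_majorant
  obtain ⟨u, hu, -, hb⟩ := h ε hε hε1 v
  have hbd : ∀ (k : Fin N → ℤ) (t : ℝ), t ∈ Set.Ioo (-1 : ℝ) 2 →
      ‖ε • (∂_{w} φ) (ε • (latticePoint k + (v + t • w)))‖ ≤ ε * u k := by
    intro k t ht
    rw [norm_smul, Real.norm_of_nonneg hε.le]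
    refine mul_le_mul_of_nonneg_left (hb k _ ?_) hε.le
    rw [norm_smul]
    have : ‖t‖ ≤ 2 := abs_le.2 ⟨by linarith [ht.1], ht.2.le⟩
    nlinarith [norm_nonneg w, norm_nonneg t]
  have hderiv : ∀ s ∈ Set.Ioo (-1 : ℝ) 2,
      HasDerivAt (fun s : ℝ => latticeSum φ ε (v + s • w))
        (∑' k : Fin N → ℤ, ε • (∂_{w} φ) (ε • (latticePoint k + (v + s • w)))) s := by
    intro s hs
    refine hasDerivAt_tsum_of_isPreconnected (hu.mul_left ε) isOpen_Ioo isPreconnected_Ioo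
      (fun k t _ => φ.hasDerivAt_comp_smul_add ε (latticePoint k) v w t) hbd
      (Set.mem_Ioo.2 ⟨neg_one_lt_zero, two_pos⟩) (summable_lattice φ hε hε1 _) hs
  have hsum : ∀ x, latticeSum (∂_{w} φ) ε x =
      ∑ i, w i • latticeSum (∂_{(Pi.single i 1 : Fin N → ℝ)} φ) ε x := by
    intro x
    simp only [latticeSum, ← tsum_const_smul'']
    rw [← Summable.tsum_finsetSum fun i _ => (summable_lattice _ hε hε1 x).const_smul _]
    refine tsum_congr fun k => ?_
    simp only [SchwartzMap.lineDerivOp_apply_eq_fderiv]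
    conv_lhs => rw [pi_eq_sum_univ' w]
    simp
  have hbound : ∀ s ∈ Set.Ico (0 : ℝ) 1,
      ‖∑' k : Fin N → ℤ, ε • (∂_{w} φ) (ε • (latticePoint k + (v + s • w)))‖ ≤ ε * (N * B) := by
    intro s _
    rw [tsum_const_smul'', norm_smul, Real.norm_of_nonneg hε.le]
    refine mul_le_mul_of_nonneg_left ?_ hε.le
    change ‖latticeSum (∂_{w} φ) ε (v + s • w)‖ ≤ _
    rw [hsum]
    calc _ ≤ ∑ _i : Fin N, B := norm_sum_le_of_le _ fun i _ => by
            rw [norm_smul]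
            have h1 := (norm_le_pi_norm w i).trans hw
            have h2 := hB i (v + s • w)
            nlinarith [norm_nonneg (w i),
              norm_nonneg (latticeSum (∂_{(Pi.single i 1 : Fin N → ℝ)} φ) ε (v + s • w))]
      _ = N * B := by simp
  simpa using norm_image_sub_le_of_norm_deriv_le_segment_01'
    (fun s hs => (hderiv s ⟨by linarith [hs.1], by linarith [hs.2]⟩).hasDerivWithinAt) hbound

/-- Lattice sums of a Schwartz function approximate its integral to every order in the mesh size,
uniformly in the translation of the lattice. -/
theorem exists_norm_latticeSum_sub_integral_le (K : ℕ) (φ : 𝓢(Fin N → ℝ, ℂ)) :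
    ∃ C, 0 ≤ C ∧ ∀ ε : ℝ, 0 < ε → ε ≤ 1 → ∀ v,
      ‖latticeSum φ ε v - (ε ^ N)⁻¹ • ∫ x, φ x‖ ≤ C * ε ^ K * (ε ^ N)⁻¹ := by
  induction K generalizing φ with
  | zero =>
    obtain ⟨C, hC, h⟩ := exists_norm_latticeSum_le φ
    refine ⟨C + ‖∫ x, φ x‖, by positivity, fun ε hε hε1 v => ?_⟩
    refine (norm_sub_le _ _).trans ?_
    rw [norm_smul, Real.norm_of_nonneg (by positivity)]
    linarith [h ε hε hε1 v]
  | succ K ih =>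
    choose C hC h using fun i : Fin N => ih (∂_{(Pi.single i 1 : Fin N → ℝ)} φ)
    refine ⟨N * ∑ i, C i, mul_nonneg (by positivity) (Finset.sum_nonneg fun i _ => hC i),
      fun ε hε hε1 v => ?_⟩
    have hB : ∀ i v, ‖latticeSum (∂_{(Pi.single i 1 : Fin N → ℝ)} φ) ε v‖ ≤
        (∑ i, C i) * ε ^ K * (ε ^ N)⁻¹ := by
      intro i v
      have h1 := h i ε hε hε1 v
      rw [SchwartzMap.integral_lineDeriv_eq_zero, smul_zero, sub_zero] at h1
      refine h1.trans ?_
      gcongr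
      exact Finset.single_le_sum (fun i _ => hC i) (Finset.mem_univ i)
    obtain ⟨hi, he⟩ := integral_latticeSum φ hε hε1 v
    have hfin : volume (unitCube N) < ⊤ := by simp [volume_unitCube]
    have hconst : latticeSum φ ε v = ∫ y in unitCube N, latticeSum φ ε v := by
      simp [Measure.real, volume_unitCube]
    rw [← he, hconst, norm_sub_rev, ← integral_sub hi (integrableOn_const hfin.ne)]
    refine (norm_setIntegral_le_of_norm_le_const hfin fun y hy =>
      norm_latticeSum_add_sub_le φ hε hε1 hB v (norm_le_one_of_mem_unitCube hy)).trans ?_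
    simp only [Measure.real, volume_unitCube]
    exact le_of_eq (by simp; ring)

end LatticeSum

theorem stmt_11 (N : ℕ) (hN : 0 < N) (φ : SchwartzMap (Fin N → ℝ) ℂ) (v : Fin N → ℝ) :
    ∀ K : ℕ, ∃ M > (0 : ℝ), ∃ ε₀ > (0 : ℝ), ∀ ε : ℝ, 0 < ε → ε < ε₀ →
      ‖(∑' k : Fin N → ℤ, φ (fun i => ε * ((k i : ℝ) + v i))) -
          ((ε : ℂ) ^ N)⁻¹ * ∫ x : Fin N → ℝ, φ x‖ ≤ M * ε ^ K := by
  intro K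
  obtain ⟨C, hC, h⟩ := exists_norm_latticeSum_sub_integral_le (K + N) φ
  refine ⟨C + 1, by positivity, 1, one_pos, fun ε hε hε1 => ?_⟩
  have h1 := h ε hε hε1.le v
  have h2 : C * ε ^ (K + N) * (ε ^ N)⁻¹ = C * ε ^ K := by
    field_simp
    ring
  rw [h2, Complex.real_smul] at h1
  push_cast at h1
  refine h1.trans ?_
  gcongr
  linarith
end

section
/- For every K ∈ ℕ, the function ε ↦ ( −∑_{n=1}^∞ log(1 − e^{−nε}) ) − π²/(6ε) + (1/2)·log(2π/ε) + ε/24 is O(ε^K) as ε → 0⁺ (here ε ranges over positive reals and log is the real logarithm; the series converges absolutely for ε > 0). -/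
/-- The logarithm of the Euler function `∏ (1 - q ^ (n + 1))` at `q = exp (-ε)`. -/
noncomputable def logEuler (ε : ℝ) : ℝ :=
  ∑' n : ℕ, Real.log (1 - Real.exp (-((n : ℝ) + 1) * ε))

lemma exp_neg_succ_mul (ε : ℝ) (n : ℕ) :
    Real.exp (-((n : ℝ) + 1) * ε) = Real.exp (-ε) ^ (n + 1) := by
  rw [← Real.exp_nat_mul]
  push_cast
  ring_nf

lemma summable_exp_neg_succ_mul {ε : ℝ} (hε : 0 < ε) :
    Summable fun n : ℕ ↦ Real.exp (-((n : ℝ) + 1) * ε) := by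
  simp_rw [exp_neg_succ_mul]
  exact (summable_nat_add_iff 1).mpr (summable_geometric_of_lt_one (Real.exp_pos _).le
    (Real.exp_lt_one_iff.mpr (by linarith)))

lemma exp_neg_succ_mul_lt_one {ε : ℝ} (hε : 0 < ε) (n : ℕ) :
    Real.exp (-((n : ℝ) + 1) * ε) < 1 := by
  have : 0 < ((n : ℝ) + 1) * ε := by positivity
  exact Real.exp_lt_one_iff.mpr (by linarith)

lemma summable_log_one_sub_exp_neg_succ_mul {ε : ℝ} (hε : 0 < ε) :
    Summable fun n : ℕ ↦ Real.log (1 - Real.exp (-((n : ℝ) + 1) * ε)) := by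
  simpa [sub_eq_add_neg] using
    Real.summable_log_one_add_of_summable (summable_exp_neg_succ_mul hε).neg

lemma exp_logEuler {ε : ℝ} (hε : 0 < ε) :
    Real.exp (logEuler ε) = ∏' n : ℕ, (1 - Real.exp (-((n : ℝ) + 1) * ε)) :=
  Real.rexp_tsum_eq_tprod (fun n ↦ sub_pos.mpr (exp_neg_succ_mul_lt_one hε n))
    (summable_log_one_sub_exp_neg_succ_mul hε)

lemma norm_eta_I_mul {ε : ℝ} (hε : 0 < ε) :
    ‖ModularForm.eta (Complex.I * ((ε / (2 * Real.pi) : ℝ) : ℂ))‖ =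
      Real.exp (-ε / 24 + logEuler ε) := by
  have hpi : (Real.pi : ℂ) ≠ 0 := mod_cast Real.pi_ne_zero
  have hmul : Multipliable fun n : ℕ ↦
      1 - ModularForm.eta_q n (Complex.I * ((ε / (2 * Real.pi) : ℝ) : ℂ)) := by
    refine ModularForm.multipliableLocallyUniformlyOn_eta.multipliable ?_
    simp only [UpperHalfPlane.upperHalfPlaneSet, Set.mem_ofPred_eq, Complex.I_mul_im,
      Complex.ofReal_re]
    positivity
  rw [ModularForm.eta, norm_mul, hmul.norm_tprod, Real.exp_add, exp_logEuler hε]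
  congr 1
  · rw [Function.Periodic.qParam, Complex.norm_exp]
    congr 1
    rw [show 2 * (Real.pi : ℂ) * Complex.I * (Complex.I * ((ε / (2 * Real.pi) : ℝ) : ℂ)) /
        ((24 : ℝ) : ℂ) = ((-ε / 24 : ℝ) : ℂ) by
      push_cast
      field_simp
      rw [Complex.I_sq]
      ring, Complex.ofReal_re]
  · refine tprod_congr fun n ↦ ?_
    rw [ModularForm.eta_q_eq_cexp]
    rw [show 2 * (Real.pi : ℂ) * Complex.I * (n + 1) *
        (Complex.I * ((ε / (2 * Real.pi) : ℝ) : ℂ)) = ((-((n : ℝ) + 1) * ε : ℝ) : ℂ) by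
      push_cast
      field_simp
      rw [Complex.I_sq]
      ring, ← Complex.ofReal_exp, ← Complex.ofReal_one, ← Complex.ofReal_sub, Complex.norm_real,
      Real.norm_of_nonneg (sub_pos.mpr (exp_neg_succ_mul_lt_one hε n)).le]

lemma Complex.norm_sqrt (z : ℂ) : ‖Complex.sqrt z‖ = ‖z‖ ^ (2⁻¹ : ℝ) := by
  rw [Complex.sqrt, ← Complex.norm_cpow_real]
  push_cast
  rfl

/-- The modular transformation of the Euler function on the positive real axis. -/
lemma logEuler_transform {ε : ℝ} (hε : 0 < ε) :
    -(4 * Real.pi ^ 2 / ε) / 24 + logEuler (4 * Real.pi ^ 2 / ε) =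
      (1 / 2) * Real.log (ε / (2 * Real.pi)) + (-ε / 24 + logEuler ε) := by
  have hpi : (Real.pi : ℂ) ≠ 0 := mod_cast Real.pi_ne_zero
  have hε0 : (ε : ℂ) ≠ 0 := mod_cast hε.ne'
  have hpos : 0 < ε / (2 * Real.pi) := by positivity
  have hmem : Complex.I * ((ε / (2 * Real.pi) : ℝ) : ℂ) ∈ UpperHalfPlane.upperHalfPlaneSet := by
    simpa only [UpperHalfPlane.upperHalfPlaneSet, Set.mem_ofPred_eq, Complex.I_mul_im,
      Complex.ofReal_re] using hpos
  have hS := congrArg norm (ModularForm.eta_comp_eq_csqrt_I_inv hmem)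
  have hinv : -1 / (Complex.I * ((ε / (2 * Real.pi) : ℝ) : ℂ)) =
      Complex.I * ((4 * Real.pi ^ 2 / ε / (2 * Real.pi) : ℝ) : ℂ) := by
    push_cast
    field_simp
    rw [Complex.I_sq]
    ring
  simp only [Function.comp_apply, Pi.smul_apply, Pi.mul_apply, smul_eq_mul, norm_mul, norm_inv,
    Complex.norm_sqrt, Complex.norm_I, Real.one_rpow, inv_one, one_mul] at hS
  rw [hinv, norm_eta_I_mul hε, norm_eta_I_mul (by positivity), Complex.norm_real,
    Real.norm_of_nonneg hpos.le, Real.rpow_def_of_pos hpos, ← Real.exp_add] at hS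
  rw [Real.exp_injective hS]
  ring

lemma abs_logEuler_le {t : ℝ} (ht : 1 ≤ t) : |logEuler t| ≤ 4 * Real.exp (-t) := by
  have ht0 : 0 < t := by linarith
  have hhalf : Real.exp (-t) ≤ 1 / 2 := by
    rw [Real.exp_neg, one_div]
    exact inv_anti₀ (by norm_num) (by linarith [Real.add_one_le_exp t])
  have hterm (n : ℕ) : ‖Real.log (1 - Real.exp (-((n : ℝ) + 1) * t))‖ ≤
      2 * Real.exp (-t) * (1 / 2) ^ n := by
    have hx0 := Real.exp_pos (-((n : ℝ) + 1) * t)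
    have hle : Real.exp (-((n : ℝ) + 1) * t) ≤ Real.exp (-t) * (1 / 2) ^ n := by
      rw [exp_neg_succ_mul, pow_succ']
      gcongr
    have hx : Real.exp (-((n : ℝ) + 1) * t) ≤ 1 / 2 := by
      refine le_trans (Real.exp_le_exp.mpr ?_) hhalf
      nlinarith [(n.cast_nonneg : (0 : ℝ) ≤ n)]
    generalize Real.exp (-((n : ℝ) + 1) * t) = x at *
    have hlog := Real.one_sub_inv_le_log_of_pos (show 0 < 1 - x by linarith)
    have hinv : (1 - x)⁻¹ ≤ 1 + 2 * x := by
      rw [inv_le_iff_one_le_mul₀ (by linarith)]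
      nlinarith
    rw [Real.norm_eq_abs, abs_of_nonpos (Real.log_nonpos (by linarith) (by linarith))]
    linarith
  have hgeom : HasSum (fun n : ℕ ↦ 2 * Real.exp (-t) * (1 / 2) ^ n) (2 * Real.exp (-t) * 2) :=
    hasSum_geometric_two.mul_left _
  calc |logEuler t| ≤ 2 * Real.exp (-t) * 2 := tsum_of_norm_bounded hgeom hterm
    _ = 4 * Real.exp (-t) := by ring

theorem stmt_12 :
    ∀ K : ℕ, ∃ M > (0 : ℝ), ∃ ε₀ > (0 : ℝ), ∀ ε : ℝ, 0 < ε → ε < ε₀ →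
      |(-∑' n : ℕ, Real.log (1 - Real.exp (-((n : ℝ) + 1) * ε))) -
          Real.pi ^ 2 / (6 * ε) + (1 / 2) * Real.log (2 * Real.pi / ε) + ε / 24| ≤
        M * ε ^ K := by
  intro K
  refine ⟨4 * K.factorial, by positivity, 1, one_pos, fun ε hε hε1 ↦ ?_⟩
  have hinv : ε⁻¹ ≤ 4 * Real.pi ^ 2 / ε := by
    rw [inv_eq_one_div]
    gcongr
    nlinarith [Real.pi_gt_three]
  have hone : 1 ≤ ε⁻¹ := (one_le_inv₀ hε).mpr hε1.le
  have hexp : Real.exp (-(4 * Real.pi ^ 2 / ε)) ≤ K.factorial * ε ^ K := by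
    calc Real.exp (-(4 * Real.pi ^ 2 / ε)) ≤ Real.exp (-ε⁻¹) := by gcongr
      _ = (Real.exp ε⁻¹)⁻¹ := Real.exp_neg _
      _ ≤ (ε⁻¹ ^ K / K.factorial)⁻¹ :=
        inv_anti₀ (by positivity) (Real.pow_div_factorial_le_exp _ (by positivity) K)
      _ = K.factorial * ε ^ K := by rw [inv_div, inv_pow, div_inv_eq_mul]
  have htrans := logEuler_transform hε
  have hlog : Real.log (2 * Real.pi / ε) = -Real.log (ε / (2 * Real.pi)) := by
    rw [← Real.log_inv, inv_div]
  have hpi : 4 * Real.pi ^ 2 / ε / 24 = Real.pi ^ 2 / (6 * ε) := by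
    field_simp
    norm_num
  change |-logEuler ε - Real.pi ^ 2 / (6 * ε) + (1 / 2) * Real.log (2 * Real.pi / ε) + ε / 24| ≤ _
  rw [show -logEuler ε - Real.pi ^ 2 / (6 * ε) + (1 / 2) * Real.log (2 * Real.pi / ε) + ε / 24 =
      -logEuler (4 * Real.pi ^ 2 / ε) by rw [hlog, ← hpi]; linarith, abs_neg]
  linarith [abs_logEuler_le (hone.trans hinv)]
end

section
/- Let N be a positive integer and A an N×N symmetric positive-definite matrix with real entries. Then there exists a unique z = (z_1, …, z_N) ∈ ℝ^N with 0 < z_i < 1 for all i and satisfying Nahm's equation 1 − z_i = ∏_{j=1}^N z_j^{A_{ij}} for i = 1, …, N (the powers being real powers of positive reals). -/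
open Matrix in
lemma Matrix.PosDef.exists_pos_mul_sq_norm_le {ι : Type*} [Fintype ι] {A : Matrix ι ι ℝ}
    (hA : A.PosDef) : ∃ c > 0, ∀ x : ι → ℝ, c * ‖x‖ ^ 2 ≤ x ⬝ᵥ A *ᵥ x := by
  rcases isEmpty_or_nonempty ι with h | h
  · exact ⟨1, one_pos, fun x => by simp [Subsingleton.elim x 0]⟩
  have hcont : Continuous fun x : ι → ℝ => x ⬝ᵥ A *ᵥ x := by fun_prop
  obtain ⟨y, hy, hmin⟩ := (isCompact_sphere (0 : ι → ℝ) 1).exists_isMinOn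
    (NormedSpace.sphere_nonempty.mpr zero_le_one) hcont.continuousOn
  have hy1 : ‖y‖ = 1 := by simpa using hy
  have hy0 : y ≠ 0 := by
    rintro rfl
    simp at hy1
  refine ⟨y ⬝ᵥ A *ᵥ y, by simpa using hA.dotProduct_mulVec_pos hy0, fun x => ?_⟩
  rcases eq_or_ne x 0 with rfl | hx
  · simp
  have hx' : 0 < ‖x‖ := norm_pos_iff.mpr hx
  have hle : y ⬝ᵥ A *ᵥ y ≤ (‖x‖⁻¹ • x) ⬝ᵥ A *ᵥ (‖x‖⁻¹ • x) :=
    hmin (by simp [norm_smul, hx'.ne'])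
  simp only [mulVec_smul, smul_dotProduct, dotProduct_smul, smul_eq_mul] at hle
  calc y ⬝ᵥ A *ᵥ y * ‖x‖ ^ 2 ≤ ‖x‖⁻¹ * (‖x‖⁻¹ * x ⬝ᵥ A *ᵥ x) * ‖x‖ ^ 2 := by gcongr
    _ = x ⬝ᵥ A *ᵥ x := by field_simp

open Matrix in
/-- A bounded continuous diagonal perturbation of a positive definite linear map has a zero,
obtained by minimising the associated potential. -/
lemma Matrix.PosDef.exists_mulVec_add_eq_zero {ι : Type*} [Fintype ι] {A : Matrix ι ι ℝ}
    (hA : A.PosDef) {h : ℝ → ℝ} (hc : Continuous h) {C : ℝ} (hC : ∀ t, |h t| ≤ C) :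
    ∃ x : ι → ℝ, ∀ i, (A *ᵥ x) i + h (x i) = 0 := by
  classical
  obtain ⟨c, hc0, hcA⟩ := hA.exists_pos_mul_sq_norm_le
  have hder (t : ℝ) : HasDerivAt (fun t => ∫ s in (0 : ℝ)..t, h s) (h t) t :=
    hc.integral_hasStrictDerivAt 0 t |>.hasDerivAt
  set G : ℝ → ℝ := fun t => ∫ s in (0 : ℝ)..t, h s with hG
  have hGc : Continuous G := continuous_iff_continuousAt.mpr fun t => (hder t).continuousAt
  have hGb (t : ℝ) : -(C * |t|) ≤ G t := by
    have := intervalIntegral.norm_integral_le_of_norm_le_const (a := 0) (b := t) (f := h)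
      (C := C) fun s _ => hC s
    rw [sub_zero, Real.norm_eq_abs] at this
    exact (abs_le.mp this).1
  have hC0 : 0 ≤ C := (abs_nonneg _).trans (hC 0)
  let F : (ι → ℝ) → ℝ := fun x => x ⬝ᵥ A *ᵥ x / 2 + ∑ i, G (x i)
  have hF : Continuous F := by fun_prop
  have hFb (x : ι → ℝ) : c * ‖x‖ ^ 2 / 2 - Fintype.card ι * (C * ‖x‖) ≤ F x := by
    have h1 : ∑ _i : ι, -(C * ‖x‖) ≤ ∑ i, G (x i) := by
      refine Finset.sum_le_sum fun i _ => le_trans ?_ (hGb (x i))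
      have := mul_le_mul_of_nonneg_left (norm_le_pi_norm x i) hC0
      rw [Real.norm_eq_abs] at this
      linarith
    simp only [Finset.sum_const, Finset.card_univ, nsmul_eq_mul] at h1
    have := hcA x
    simp only [F]
    linarith
  obtain ⟨x, hx⟩ := hF.exists_forall_le' 0 (by
    filter_upwards [tendsto_norm_cocompact_atTop.eventually_ge_atTop
      (2 * (Fintype.card ι * C) / c)] with x hx
    rw [div_le_iff₀ hc0] at hx
    have h0 : F 0 = 0 := by simp [F, hG]
    rw [h0]
    refine le_trans ?_ (hFb x)
    nlinarith [mul_le_mul_of_nonneg_right hx (norm_nonneg x)])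
  refine ⟨x, fun i => ?_⟩
  have hsymm : x ⬝ᵥ A *ᵥ Pi.single i 1 = (A *ᵥ x) i := by
    have hT : Aᵀ = A := by simpa [conjTranspose_eq_transpose_of_trivial] using hA.isHermitian.eq
    rw [dotProduct_mulVec, ← mulVec_transpose, hT, dotProduct_single_one]
  have hQ (t : ℝ) : (x + t • Pi.single i 1) ⬝ᵥ A *ᵥ (x + t • Pi.single i 1) =
      x ⬝ᵥ A *ᵥ x + 2 * t * (A *ᵥ x) i + t ^ 2 * A i i := by
    have h2 : (Pi.single i 1 : ι → ℝ) ⬝ᵥ A *ᵥ Pi.single i 1 = A i i := by simp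
    simp only [mulVec_add, mulVec_smul, add_dotProduct, dotProduct_add, smul_dotProduct,
      dotProduct_smul, hsymm, h2, single_one_dotProduct, smul_eq_mul]
    ring
  have hd : HasDerivAt (fun t : ℝ => F (x + t • Pi.single i 1)) ((A *ᵥ x) i + h (x i)) 0 := by
    have hq : HasDerivAt (fun t : ℝ => (x ⬝ᵥ A *ᵥ x + 2 * t * (A *ᵥ x) i + t ^ 2 * A i i) / 2)
        ((A *ᵥ x) i) 0 := by
      have := (((((hasDerivAt_id (0 : ℝ)).const_mul 2).mul_const ((A *ᵥ x) i)).const_add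
        (x ⬝ᵥ A *ᵥ x)).add (((hasDerivAt_id (0 : ℝ)).pow 2).mul_const (A i i))).div_const 2
      exact this.congr_deriv (by simp)
    have hs : HasDerivAt (fun t : ℝ => ∑ j, G ((x + t • (Pi.single i 1 : ι → ℝ)) j)) (h (x i)) 0 := by
      have hj (j : ι) : HasDerivAt (fun t : ℝ => G ((x + t • (Pi.single i 1 : ι → ℝ)) j))
          (h (x j) * (Pi.single i 1 : ι → ℝ) j) 0 := by
        have hl : HasDerivAt (fun t : ℝ => (x + t • (Pi.single i 1 : ι → ℝ)) j)
            ((Pi.single i 1 : ι → ℝ) j) 0 := by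
          simpa using ((hasDerivAt_id (0 : ℝ)).mul_const
            ((Pi.single i 1 : ι → ℝ) j)).const_add (x j)
        exact HasDerivAt.comp (0 : ℝ) (by simpa using hder (x j)) hl
      exact (HasDerivAt.fun_sum (u := Finset.univ) fun j _ => hj j).congr_deriv
        (by simp [Pi.single_apply])
    simp only [F, hQ]
    exact hq.add hs
  refine IsLocalMin.hasDerivAt_eq_zero (Filter.Eventually.of_forall fun t => ?_) hd
  simpa using hx _

lemma neg_mul_log_one_sub_exp_neg_le_one {x : ℝ} (hx : 0 < x) :
    -(x * Real.log (1 - Real.exp (-x))) ≤ 1 := by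
  have h1 : 0 < 1 - Real.exp (-x) := by simpa using hx
  have h2 := Real.one_sub_inv_le_log_of_pos h1
  have h3 : x / (1 + x) ≤ 1 - Real.exp (-x) := by
    have : Real.exp (-x) ≤ (1 + x)⁻¹ := by
      rw [Real.exp_neg]
      gcongr
      linarith [Real.add_one_le_exp x]
    have e : x / (1 + x) = 1 - (1 + x)⁻¹ := by field_simp; ring
    linarith
  have h4 : (1 - Real.exp (-x))⁻¹ ≤ (x / (1 + x))⁻¹ := by gcongr
  have h5 : x * (x / (1 + x))⁻¹ = 1 + x := by field_simp
  nlinarith [mul_le_mul_of_nonneg_left h4 hx.le, mul_le_mul_of_nonneg_left h2 hx.le]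

lemma strictMonoOn_log_one_sub_exp_neg :
    StrictMonoOn (fun x : ℝ => Real.log (1 - Real.exp (-x))) (Set.Ioi 0) := by
  intro x hx y _ hxy
  have hx : 0 < x := hx
  refine Real.log_lt_log (by simpa using hx) ?_
  have : Real.exp (-y) < Real.exp (-x) := Real.exp_lt_exp.mpr (by linarith)
  linarith

open Filter Topology in
lemma tendsto_log_one_sub_exp_neg :
    Tendsto (fun x : ℝ => Real.log (1 - Real.exp (-x))) (𝓝[>] 0) atBot := by
  refine Real.tendsto_log_nhdsGT_zero.comp (tendsto_nhdsWithin_iff.mpr ⟨?_, ?_⟩)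
  · have : Continuous fun x : ℝ => 1 - Real.exp (-x) := by fun_prop
    simpa using (this.tendsto 0).mono_left nhdsWithin_le_nhds
  · filter_upwards [self_mem_nhdsWithin] with x hx
    simpa using hx

open Matrix Filter Topology in
/-- Nahm's equation in the coordinates `x = -log z`, existence. -/
lemma Matrix.PosDef.exists_mulVec_add_log_eq_zero {ι : Type*} [Fintype ι] {A : Matrix ι ι ℝ}
    (hA : A.PosDef) :
    ∃ x : ι → ℝ, ∀ i, 0 < x i ∧ (A *ᵥ x) i + Real.log (1 - Real.exp (-x i)) = 0 := by
  obtain ⟨c, hc0, hcA⟩ := hA.exists_pos_mul_sq_norm_le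
  set n : ℝ := (Fintype.card ι : ℝ) with hn
  obtain ⟨B, hB⟩ : ∃ B, ∀ x : ι → ℝ, ‖x‖ ≤ √(n / c) → ‖A *ᵥ x‖ ≤ B := by
    have hcont : Continuous fun x : ι → ℝ => A *ᵥ x := by fun_prop
    obtain ⟨B, hB⟩ := (isCompact_closedBall (0 : ι → ℝ) √(n / c)).exists_bound_of_continuousOn
      hcont.continuousOn
    exact ⟨B, fun x hx => hB x (by simpa using hx)⟩
  obtain ⟨ε, hεB, hε⟩ := ((tendsto_log_one_sub_exp_neg.eventually_lt_atBot (-B)).and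
    self_mem_nhdsWithin).exists
  have hε : 0 < ε := hε
  have hpos (t : ℝ) : 0 < max t ε := lt_max_of_lt_right hε
  set g : ℝ → ℝ := fun t => Real.log (1 - Real.exp (-t)) with hg
  have hneg (t : ℝ) (ht : 0 < t) : g t ≤ 0 :=
    Real.log_nonpos (by simpa using ht.le) (by linarith [Real.exp_pos (-t)])
  have hcont : Continuous fun t => g (max t ε) := by
    refine Continuous.log (by fun_prop) fun t => ne_of_gt ?_
    simpa using hpos t
  have hbound (t : ℝ) : |g (max t ε)| ≤ -g ε := by
    rw [abs_of_nonpos (hneg _ (hpos t))]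
    exact neg_le_neg (strictMonoOn_log_one_sub_exp_neg.monotoneOn hε (hpos t) (le_max_right _ _))
  obtain ⟨x, hx⟩ := hA.exists_mulVec_add_eq_zero hcont hbound
  have hxg (t : ℝ) : -(t * g (max t ε)) ≤ 1 := by
    have h1 := neg_mul_log_one_sub_exp_neg_le_one (hpos t)
    have h2 := mul_le_mul_of_nonneg_right (le_max_left t ε) (neg_nonneg.mpr (hneg _ (hpos t)))
    linarith
  have hnorm : ‖x‖ ≤ √(n / c) := by
    refine Real.le_sqrt_of_sq_le ((le_div_iff₀' hc0).mpr ((hcA x).trans ?_))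
    calc x ⬝ᵥ A *ᵥ x = ∑ i, -(x i * g (max (x i) ε)) :=
          Finset.sum_congr rfl fun i _ => by rw [eq_neg_of_add_eq_zero_left (hx i)]; ring
      _ ≤ ∑ _i : ι, (1 : ℝ) := Finset.sum_le_sum fun i _ => hxg (x i)
      _ = n := by simp [hn]
  refine ⟨x, fun i => ?_⟩
  have hlt : ε < x i := by
    by_contra! hle
    have h1 := hx i
    simp only [max_eq_right hle] at h1
    have h2 := (le_abs_self _).trans ((norm_le_pi_norm (A *ᵥ x) i).trans (hB x hnorm))
    linarith
  exact ⟨hε.trans hlt, by simpa [max_eq_left hlt.le] using hx i⟩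

open Matrix in
/-- Nahm's equation in the coordinates `x = -log z`, uniqueness. -/
lemma Matrix.PosDef.eq_of_mulVec_add_log_eq_zero {ι : Type*} [Fintype ι] {A : Matrix ι ι ℝ}
    (hA : A.PosDef) {x y : ι → ℝ}
    (hx : ∀ i, 0 < x i ∧ (A *ᵥ x) i + Real.log (1 - Real.exp (-x i)) = 0)
    (hy : ∀ i, 0 < y i ∧ (A *ᵥ y) i + Real.log (1 - Real.exp (-y i)) = 0) : x = y := by
  by_contra hne
  have hpos : 0 < (x - y) ⬝ᵥ A *ᵥ (x - y) := by
    simpa using hA.dotProduct_mulVec_pos (sub_ne_zero.mpr hne)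
  refine hpos.not_ge (Finset.sum_nonpos fun i _ => ?_)
  have hmono := strictMonoOn_log_one_sub_exp_neg.monotoneOn
  rw [mulVec_sub, Pi.sub_apply, Pi.sub_apply, eq_neg_of_add_eq_zero_left (hx i).2,
    eq_neg_of_add_eq_zero_left (hy i).2]
  rcases le_total (x i) (y i) with h | h
  · have := hmono (hx i).1 (hy i).1 h
    exact mul_nonpos_of_nonpos_of_nonneg (by linarith) (by simp only at this; linarith)
  · have := hmono (hy i).1 (hx i).1 h
    exact mul_nonpos_of_nonneg_of_nonpos (by linarith) (by simp only at this; linarith)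

open Matrix in
lemma one_sub_eq_prod_rpow_iff {ι : Type*} [Fintype ι] (A : Matrix ι ι ℝ) {x : ι → ℝ} {i : ι}
    (hx : 0 < x i) :
    1 - Real.exp (-x i) = ∏ j, Real.exp (-x j) ^ A i j ↔
      (A *ᵥ x) i + Real.log (1 - Real.exp (-x i)) = 0 := by
  have h1 : 0 < 1 - Real.exp (-x i) := by simpa using hx
  have h2 : ∏ j, Real.exp (-x j) ^ A i j = Real.exp (-(A *ᵥ x) i) := by
    simp_rw [← Real.exp_mul, ← Real.exp_sum, mulVec, dotProduct, ← Finset.sum_neg_distrib]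
    congr! 2
    ring
  rw [h2, ← Real.log_injOn_pos.eq_iff h1 (Real.exp_pos _), Real.log_exp]
  constructor <;> intro h <;> linarith

theorem stmt_15 (N : ℕ) (hN : 0 < N)
    (A : Matrix (Fin N) (Fin N) ℝ) (hAsymm : A.IsSymm) (hApos : A.PosDef) :
    ∃! z : Fin N → ℝ, (∀ i, z i ∈ Set.Ioo (0 : ℝ) 1) ∧
      ∀ i, 1 - z i = ∏ j, z j ^ (A i j) := by
  obtain ⟨x, hx⟩ := hApos.exists_mulVec_add_log_eq_zero
  refine ⟨fun i => Real.exp (-x i), ⟨fun i => ⟨Real.exp_pos _, by simpa using (hx i).1⟩,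
    fun i => (one_sub_eq_prod_rpow_iff A (hx i).1).mpr (hx i).2⟩, ?_⟩
  rintro z ⟨hz, hzA⟩
  obtain ⟨y, rfl⟩ : ∃ y : Fin N → ℝ, z = fun i => Real.exp (-y i) :=
    ⟨fun i => -Real.log (z i), funext fun i => by simp [Real.exp_log (hz i).1]⟩
  have hy (i : Fin N) : 0 < y i := by simpa using (hz i).2
  have hyx := hApos.eq_of_mulVec_add_log_eq_zero
    (fun i => ⟨hy i, (one_sub_eq_prod_rpow_iff A (hy i)).mp (hzA i)⟩) hx
  rw [hyx]
end
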